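/- For G(x,y) = -x·y³ + x⁵ + y⁵, the family L(ε) = G'(ε³, ε⁴) : ℝ² → ℝ equals [4ε¹², ε¹¹·(-3+5ε⁵)]; it is 11-surjective and not j-surjective for any j < 11: the minimal k such that for every c ∈ ℝ there is a polynomial curve b(ε) of degree ≤ k with L(ε)·b(ε) = ε^k·c + O(ε^{k+1}) is k = 11. -/

import Mathlib

open Asymptotics

/-- The family of directional derivatives of `G(x,y) = -xy³+x⁵+y⁵` along `z(ε)=(ε³,ε⁴)`. -/
noncomputable def Lfam6 (ε : ℝ) : ℝ × ℝ →L[ℝ] ℝ :=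
  fderiv ℝ (fun p : ℝ × ℝ => -p.1 * p.2 ^ 3 + p.1 ^ 5 + p.2 ^ 5) (ε ^ 3, ε ^ 4)

/-- k-surjectivity of the family `Lfam6`: for every `c ∈ ℝ` there is a polynomial curve
`b(ε)` of degree ≤ k with `L(ε)·b(ε) = ε^k·c + O(ε^{k+1})` near `ε = 0`. -/
def kSurj6 (k : ℕ) : Prop :=
  ∀ c : ℝ, ∃ b : Fin (k + 1) → ℝ × ℝ,
    (fun ε : ℝ => Lfam6 ε (∑ i : Fin (k + 1), ε ^ (i : ℕ) • b i) - ε ^ k * c)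
      =O[nhds 0] fun ε : ℝ => ε ^ (k + 1)

theorem Lfam6_apply (ε : ℝ) (v : ℝ × ℝ) :
    Lfam6 ε v = 4 * ε ^ 12 * v.1 + ε ^ 11 * (-3 + 5 * ε ^ 5) * v.2 := by
  have h1 : HasFDerivAt (fun p : ℝ × ℝ => p.1) (ContinuousLinearMap.fst ℝ ℝ ℝ) (ε ^ 3, ε ^ 4) :=
    hasFDerivAt_fst
  have h2 : HasFDerivAt (fun p : ℝ × ℝ => p.2) (ContinuousLinearMap.snd ℝ ℝ ℝ) (ε ^ 3, ε ^ 4) :=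
    hasFDerivAt_snd
  have h : HasFDerivAt (fun p : ℝ × ℝ => -p.1 * p.2 ^ 3 + p.1 ^ 5 + p.2 ^ 5) _ (ε ^ 3, ε ^ 4) :=
    ((h1.fun_neg.fun_mul (HasFDerivAt.pow h2 3)).fun_add (HasFDerivAt.pow h1 5)).fun_add (HasFDerivAt.pow h2 5)
  rw [Lfam6, h.fderiv]
  simp
  ring

theorem isBigO_pow_mul_of_continuous {g : ℝ → ℝ} (hg : Continuous g) {m n : ℕ} (h : n ≤ m) :
    (fun ε : ℝ => ε ^ m * g ε) =O[nhds 0] fun ε : ℝ => ε ^ n := by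
  have hbound : (fun ε : ℝ => ε ^ (m - n) * g ε) =O[nhds 0] fun _ => (1 : ℝ) :=
    ((continuous_pow (m - n)).mul hg).continuousAt.isBigO_one ℝ
  have hmul := (isBigO_refl (fun ε : ℝ => ε ^ n) (nhds 0)).mul hbound
  simpa only [← mul_assoc, ← pow_add, Nat.add_sub_cancel' h, mul_one] using hmul

theorem not_isBigO_pow_succ (k : ℕ) :
    ¬ (fun ε : ℝ => ε ^ k) =O[nhds 0] fun ε : ℝ => ε ^ (k + 1) := by
  intro h
  refine isLittleO_irrefl ?_ (h.trans_isLittleO (isLittleO_pow_pow k.lt_succ_self))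
  have hne : ∃ᶠ ε : ℝ in nhds 0, ε ≠ 0 :=
    (eventually_mem_nhdsWithin (a := (0 : ℝ)) (s := {0}ᶜ)).frequently.filter_mono
      nhdsWithin_le_nhds
  exact hne.mono fun ε hε => pow_ne_zero k hε

theorem kSurj6_eleven : kSurj6 11 := by
  intro c
  refine ⟨fun i => if i = 0 then (0, -c / 3) else 0, ?_⟩
  refine (isBigO_pow_mul_of_continuous (g := fun _ => -(5 * c / 3))
    continuous_const (show 12 ≤ 16 by norm_num)).congr_left fun ε => ?_
  rw [Lfam6_apply]
  simp
  ring

theorem le_of_kSurj6 {k : ℕ} (hk : kSurj6 k) : 11 ≤ k := by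
  by_contra! hlt
  obtain ⟨b, hb⟩ := hk 1
  have hcurve : Continuous fun ε : ℝ => ∑ i : Fin (k + 1), ε ^ (i : ℕ) • b i := by fun_prop
  have hL : (fun ε : ℝ => Lfam6 ε (∑ i : Fin (k + 1), ε ^ (i : ℕ) • b i))
      =O[nhds 0] fun ε : ℝ => ε ^ (k + 1) := by
    refine (isBigO_pow_mul_of_continuous
      (g := fun ε => 4 * ε * (∑ i : Fin (k + 1), ε ^ (i : ℕ) • b i).1
        + (-3 + 5 * ε ^ 5) * (∑ i : Fin (k + 1), ε ^ (i : ℕ) • b i).2)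
      (by fun_prop) (show k + 1 ≤ 11 from hlt)).congr_left fun ε => ?_
    rw [Lfam6_apply]
    ring
  exact not_isBigO_pow_succ k ((hL.sub hb).congr_left fun ε => by ring)

/-- `L(ε) = G'(ε³, ε⁴) = [4ε¹², ε¹¹(-3+5ε⁵)]`; it is 11-surjective and not
j-surjective for any `j < 11`, i.e. 11 is the least `k` with k-surjectivity. -/
theorem stmt_6 :
    (∀ ε : ℝ, ∀ v : ℝ × ℝ,
      Lfam6 ε v = 4 * ε ^ 12 * v.1 + ε ^ 11 * (-3 + 5 * ε ^ 5) * v.2) ∧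
    IsLeast {k : ℕ | kSurj6 k} 11 :=
  ⟨Lfam6_apply, kSurj6_eleven, fun _ hk => le_of_kSurj6 hk⟩
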